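/- Let l ≥ 4π and define u on the unit cone ball C_1 of length l by u(r, θ) = r sin θ for θ ∈ [0, π], u(r, θ) = r sin(θ − l/2) for θ ∈ [l/2, l/2 + π], and u(r, θ) = 0 for all other θ ∈ [0, l], extended l-periodically in θ. Then u is a minimizer of J(C_1, 1, 0): for every Lipschitz function w on the cone with w(1, θ) = u(1, θ) for all θ, J(u, C_1) ≤ J(w, C_1). In particular, on a cone of length l ≥ 4π there is a one-phase minimizer with two distinct positive phases meeting at the vertex. -/

import Mathlib

open MeasureTheory Set

noncomputable section

/-- The cone distance on the cone of length `l`, in polar coordinates: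
`d((r,θ),(s,φ)) = sqrt(r² + s² − 2 r s cos(min(δ, π)))` with
`δ = min_{k ∈ ℤ} |θ − φ + k l|`. -/
def coneDist (l : ℝ) (p q : ℝ × ℝ) : ℝ :=
  Real.sqrt (p.1 ^ 2 + q.1 ^ 2 -
    2 * p.1 * q.1 * Real.cos (min (⨅ k : ℤ, |p.2 - q.2 + (k : ℝ) * l|) Real.pi))

/-- A Lipschitz function on the cone ball `C_R` of the cone of length `l`, given in
polar coordinates: `l`-periodic in `θ` and Lipschitz for the cone distance (this forces
a well-defined vertex value `u 0 _` and continuity at the vertex). -/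
structure ConeLip (l R : ℝ) (u : ℝ → ℝ → ℝ) : Prop where
  periodic : ∀ r θ : ℝ, u r (θ + l) = u r θ
  lipschitz : ∃ K : ℝ, ∀ p q : ℝ × ℝ, p.1 ∈ Set.Icc 0 R → q.1 ∈ Set.Icc 0 R →
    |u p.1 p.2 - u q.1 q.2| ≤ K * coneDist l p q

/-- The squared cone gradient `|Du|² = (∂_r u)² + (∂_θ u)²/r²` at a polar point,
computed from Lean's a.e.-defined derivatives. -/
def gradSq (u : ℝ → ℝ → ℝ) (p : ℝ × ℝ) : ℝ :=
  (deriv (fun s => u s p.2) p.1) ^ 2 + (deriv (fun φ => u p.1 φ) p.2) ^ 2 / p.1 ^ 2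

/-- The two-phase functional
`J(u, C_R) = ∫_{C_R} |Du|² + λ₊ area({u > 0} ∩ C_R) + λ₋ area({u < 0} ∩ C_R)`,
computed in polar coordinates with area measure `r dr dθ`, `θ` ranging over `(0, l)`. -/
def Jfun (l lp lm : ℝ) (u : ℝ → ℝ → ℝ) (R : ℝ) : ℝ :=
  ∫ p in Set.Ioo (0:ℝ) R ×ˢ Set.Ioo (0:ℝ) l,
    (gradSq u p + (if 0 < u p.1 p.2 then lp else 0)
      + (if u p.1 p.2 < 0 then lm else 0)) * p.1

/-- The Dirichlet energy `∫_{C_R} |Du|²` with respect to the area measure `r dr dθ`. -/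
def Dir (l : ℝ) (u : ℝ → ℝ → ℝ) (R : ℝ) : ℝ :=
  ∫ p in Set.Ioo (0:ℝ) R ×ˢ Set.Ioo (0:ℝ) l, gradSq u p * p.1

/-- `u` is a minimizer of `J(C_R, λ₊, λ₋)` on the cone of length `l`: a cone Lipschitz
function beating every cone Lipschitz competitor with the same boundary values on
`{r = R}`. -/
def IsMinimizerJ (l lp lm R : ℝ) (u : ℝ → ℝ → ℝ) : Prop :=
  ConeLip l R u ∧ ∀ w : ℝ → ℝ → ℝ, ConeLip l R w → (∀ θ : ℝ, w R θ = u R θ) →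
    Jfun l lp lm u R ≤ Jfun l lp lm w R

/-- The representative of `θ` modulo `l` in `[0, l)`. -/
def thetaMod (l θ : ℝ) : ℝ := θ - l * (⌊θ / l⌋ : ℝ)

/-- The two-bump one-phase profile on the cone of length `l`:
`u(r,θ) = r sin θ` for `θ ∈ [0, π]`, `u(r,θ) = r sin(θ − l/2)` for
`θ ∈ [l/2, l/2 + π]`, and `u = 0` for all other `θ ∈ [0, l]`, extended
`l`-periodically. -/
def uTwoPhase (l : ℝ) (r θ : ℝ) : ℝ :=
  if thetaMod l θ ≤ Real.pi then r * Real.sin (thetaMod l θ)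
  else if l / 2 ≤ thetaMod l θ ∧ thetaMod l θ ≤ l / 2 + Real.pi then
    r * Real.sin (thetaMod l θ - l / 2)
  else 0

/-! ### The profile is Lipschitz on the cone -/

/-- A single bump. -/
def bumpS (t : ℝ) : ℝ := Real.sin (max 0 (min t Real.pi))

lemma bumpS_lip (s t : ℝ) : |bumpS s - bumpS t| ≤ |s - t| := by
  have h1 : |bumpS s - bumpS t| ≤ |max 0 (min s Real.pi) - max 0 (min t Real.pi)| := by
    have := Real.lipschitzWith_sin.dist_le_mul (max 0 (min s Real.pi)) (max 0 (min t Real.pi))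
    simpa [Real.dist_eq, bumpS] using this
  refine h1.trans ((abs_max_sub_max_le_max _ _ _ _).trans ?_)
  simp only [sub_self, abs_zero]
  refine max_le (abs_nonneg _) ((abs_min_sub_min_le_max _ _ _ _).trans ?_)
  simp

lemma bumpS_of_nonpos {t : ℝ} (h : t ≤ 0) : bumpS t = 0 := by
  have : min t Real.pi ≤ 0 := (min_le_left _ _).trans h
  simp [bumpS, max_eq_left this]

lemma bumpS_of_ge {t : ℝ} (h : Real.pi ≤ t) : bumpS t = 0 := by
  simp [bumpS, min_eq_right h, max_eq_right Real.pi_pos.le]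

lemma bumpS_of_mem {t : ℝ} (h0 : 0 ≤ t) (h : t ≤ Real.pi) : bumpS t = Real.sin t := by
  simp [bumpS, min_eq_left h, max_eq_right h0]

lemma bumpS_mem (t : ℝ) : 0 ≤ bumpS t ∧ bumpS t ≤ 1 :=
  ⟨Real.sin_nonneg_of_nonneg_of_le_pi (le_max_left _ _)
    (max_le Real.pi_pos.le (min_le_right _ _)), Real.sin_le_one _⟩

/-- The profile on one period. -/
def prof (l t : ℝ) : ℝ := bumpS t + bumpS (t - l / 2)

lemma prof_lip (l s t : ℝ) : |prof l s - prof l t| ≤ 2 * |s - t| := by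
  have h1 := bumpS_lip s t
  have h2 := bumpS_lip (s - l / 2) (t - l / 2)
  have : prof l s - prof l t = (bumpS s - bumpS t) + (bumpS (s - l/2) - bumpS (t - l/2)) := by
    simp only [prof]; ring
  rw [this]
  refine (abs_add_le _ _).trans ?_
  have e : s - l / 2 - (t - l / 2) = s - t := by ring
  rw [e] at h2
  linarith

lemma prof_mem (l t : ℝ) : 0 ≤ prof l t ∧ prof l t ≤ 2 := by
  have h1 := bumpS_mem t
  have h2 := bumpS_mem (t - l / 2)
  unfold prof; constructor <;> linarith [h1.1, h1.2, h2.1, h2.2]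

lemma thetaMod_mem {l : ℝ} (hl : 0 < l) (θ : ℝ) : 0 ≤ thetaMod l θ ∧ thetaMod l θ < l := by
  have h1 := Int.floor_le (θ / l)
  have h2 := Int.lt_floor_add_one (θ / l)
  rw [le_div_iff₀ hl] at h1
  rw [div_lt_iff₀ hl] at h2
  unfold thetaMod
  constructor <;> nlinarith

lemma thetaMod_add {l : ℝ} (hl : 0 < l) (θ : ℝ) : thetaMod l (θ + l) = thetaMod l θ := by
  unfold thetaMod
  rw [add_div, div_self hl.ne', Int.floor_add_one]
  push_cast; ring

lemma thetaMod_of_mem {l θ : ℝ} (h0 : 0 ≤ θ) (h : θ < l) : thetaMod l θ = θ := by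
  have : ⌊θ / l⌋ = 0 := by
    rw [Int.floor_eq_zero_iff]
    exact ⟨div_nonneg h0 (h0.trans h.le), (div_lt_one (lt_of_le_of_lt h0 h)).2 h⟩
  simp [thetaMod, this]

lemma uTwoPhase_eq {l : ℝ} (hl : 4 * Real.pi ≤ l) (r θ : ℝ) :
    uTwoPhase l r θ = r * prof l (thetaMod l θ) := by
  have hpi := Real.pi_pos
  have hm := thetaMod_mem (by linarith : 0 < l) θ
  unfold uTwoPhase prof
  generalize thetaMod l θ = t at *
  split_ifs with h1 h2
  · rw [bumpS_of_mem hm.1 h1, bumpS_of_nonpos (by linarith)]; ring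
  · rw [bumpS_of_ge (by linarith), bumpS_of_mem (by linarith) (by linarith)]; ring
  · rw [bumpS_of_ge (by linarith)]
    by_cases h3 : l / 2 ≤ t
    · rw [bumpS_of_ge]
      · ring
      · by_contra h4
        exact h2 ⟨h3, by linarith⟩
    · rw [bumpS_of_nonpos (by linarith)]; ring

lemma prof_per_lip {l : ℝ} (hl : 4 * Real.pi ≤ l) (θ φ : ℝ) :
    |prof l (thetaMod l θ) - prof l (thetaMod l φ)| ≤ 2 * |θ - φ| := by
  have hpi := Real.pi_pos
  have hl0 : 0 < l := by linarith
  wlog h : θ ≤ φ generalizing θ φ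
  · rw [abs_sub_comm, abs_sub_comm θ]
    exact this φ θ (le_of_not_ge h)
  have h1 := thetaMod_mem hl0 θ
  have h2 := thetaMod_mem hl0 φ
  have hf : ⌊θ / l⌋ ≤ ⌊φ / l⌋ := Int.floor_le_floor (by gcongr)
  rcases hf.eq_or_lt with he | hlt
  · have : thetaMod l θ - thetaMod l φ = θ - φ := by
      unfold thetaMod; rw [he]; ring
    rw [← this]
    exact prof_lip _ _ _
  · have hlt' : (⌊θ / l⌋ : ℝ) + 1 ≤ ⌊φ / l⌋ := by exact_mod_cast hlt
    have key : (l - thetaMod l θ) + thetaMod l φ ≤ φ - θ := by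
      unfold thetaMod; nlinarith
    have a1 := prof_lip l (thetaMod l θ) l
    have a2 := prof_lip l 0 (thetaMod l φ)
    have e1 : prof l l = 0 := by
      unfold prof; rw [bumpS_of_ge (by linarith), bumpS_of_ge (by linarith)]; ring
    have e2 : prof l 0 = 0 := by
      unfold prof; rw [bumpS_of_nonpos le_rfl, bumpS_of_nonpos (by linarith)]; ring
    rw [abs_sub_comm (thetaMod l θ), abs_of_nonneg (by linarith : 0 ≤ l - thetaMod l θ)] at a1
    rw [abs_sub_comm (0:ℝ), abs_of_nonneg (by linarith : 0 ≤ thetaMod l φ - 0)] at a2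
    rw [abs_sub_comm θ, abs_of_nonneg (by linarith : 0 ≤ φ - θ)]
    rw [e1] at a1; rw [e2] at a2
    have := abs_sub_le (prof l (thetaMod l θ)) 0 (prof l (thetaMod l φ))
    linarith

lemma thetaMod_add_int {l : ℝ} (hl : 0 < l) (θ : ℝ) (k : ℤ) :
    thetaMod l (θ + k * l) = thetaMod l θ := by
  unfold thetaMod
  rw [add_div, mul_div_assoc, div_self hl.ne', mul_one, Int.floor_add_intCast]
  push_cast; ring

lemma prof_le_inf {l : ℝ} (hl : 4 * Real.pi ≤ l) (θ φ : ℝ) :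
    |prof l (thetaMod l θ) - prof l (thetaMod l φ)| ≤
      2 * min (⨅ k : ℤ, |θ - φ + (k : ℝ) * l|) Real.pi := by
  have hpi := Real.pi_gt_three
  have hl0 : 0 < l := by linarith
  rw [← div_le_iff₀' (by norm_num)]
  refine le_min (le_ciInf fun k => ?_) ?_
  · have := prof_per_lip hl (θ + k * l) φ
    rw [thetaMod_add_int hl0] at this
    rw [div_le_iff₀' (by norm_num)]
    have e : θ - φ + k * l = θ + k * l - φ := by ring
    rw [e]; exact this
  · have h1 := prof_mem l (thetaMod l θ)
    have h2 := prof_mem l (thetaMod l φ)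
    rw [div_le_iff₀' (by norm_num), abs_le]
    constructor <;> linarith [h1.1, h1.2, h2.1, h2.2]

lemma one_sub_cos_ge {m : ℝ} (h0 : 0 ≤ m) (h : m ≤ Real.pi) :
    2 * m ^ 2 / Real.pi ^ 2 ≤ 1 - Real.cos m := by
  have hpi := Real.pi_pos
  have h1 := Real.mul_le_sin (x := m / 2) (by linarith) (by linarith)
  have h2 : Real.cos m = 1 - 2 * Real.sin (m / 2) ^ 2 := by
    have := Real.cos_two_mul (m / 2)
    rw [mul_div_cancel₀ _ (by norm_num : (2:ℝ) ≠ 0)] at this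
    rw [this, Real.cos_sq']; ring
  rw [h2]
  have h3 : (2 / Real.pi * (m / 2)) ^ 2 ≤ Real.sin (m / 2) ^ 2 := by
    gcongr
  have h4 : (2 / Real.pi * (m / 2)) ^ 2 = m ^ 2 / Real.pi ^ 2 := by
    field_simp
  rw [h4] at h3
  have : 2 * m ^ 2 / Real.pi ^ 2 = 2 * (m ^ 2 / Real.pi ^ 2) := by ring
  linarith

lemma coneDist_aux {r s m : ℝ} (hr : 0 ≤ r) (hs : s ≤ r) (hs0 : 0 ≤ s) (h0 : 0 ≤ m)
    (h : m ≤ Real.pi) :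
    |r - s| ≤ Real.sqrt (r ^ 2 + s ^ 2 - 2 * r * s * Real.cos m) ∧
    s * m ≤ 2 * Real.sqrt (r ^ 2 + s ^ 2 - 2 * r * s * Real.cos m) := by
  have hpi := Real.pi_pos
  have hpi4 := Real.pi_le_four
  have hc := one_sub_cos_ge h0 h
  have hrs : 0 ≤ r * s := mul_nonneg hr hs0
  constructor
  · apply Real.abs_le_sqrt
    nlinarith [Real.cos_le_one m]
  · have : s * m / 2 ≤ Real.sqrt (r ^ 2 + s ^ 2 - 2 * r * s * Real.cos m) := by
      apply Real.le_sqrt_of_sq_le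
      have h16 : m ^ 2 / 8 ≤ 2 * m ^ 2 / Real.pi ^ 2 := by
        rw [div_le_div_iff₀ (by norm_num) (by positivity)]
        have : Real.pi ^ 2 ≤ 16 := by nlinarith
        nlinarith [sq_nonneg m]
      have h1 : s ^ 2 ≤ r * s := by nlinarith
      have h2 : s ^ 2 * (m ^ 2 / 8) ≤ r * s * (1 - Real.cos m) := by
        apply mul_le_mul h1 (h16.trans hc) (by positivity) hrs
      nlinarith [sq_nonneg (r - s)]
    linarith

lemma uTwoPhase_lip_aux {r s m a b : ℝ} (hr : 0 ≤ r) (hs : s ≤ r) (hs0 : 0 ≤ s) (h0 : 0 ≤ m)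
    (h : m ≤ Real.pi) (ha : 0 ≤ a ∧ a ≤ 2) (hab : |a - b| ≤ 2 * m) :
    |r * a - s * b| ≤ 6 * Real.sqrt (r ^ 2 + s ^ 2 - 2 * r * s * Real.cos m) := by
  obtain ⟨h1, h2⟩ := coneDist_aux hr hs hs0 h0 h
  have : r * a - s * b = (r - s) * a + s * (a - b) := by ring
  rw [this]
  refine (abs_add_le _ _).trans ?_
  rw [abs_mul, abs_mul, abs_of_nonneg ha.1, abs_of_nonneg hs0]
  have h3 : |r - s| * a ≤ |r - s| * 2 := by gcongr; exact ha.2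
  have h4 : s * |a - b| ≤ s * (2 * m) := by gcongr
  linarith

lemma uTwoPhase_coneLip {l : ℝ} (hl : 4 * Real.pi ≤ l) : ConeLip l 1 (uTwoPhase l) := by
  have hpi := Real.pi_pos
  have hl0 : 0 < l := by linarith
  refine ⟨fun r θ => ?_, 6, fun p q hp hq => ?_⟩
  · rw [uTwoPhase_eq hl, uTwoPhase_eq hl, thetaMod_add hl0]
  · rw [uTwoPhase_eq hl, uTwoPhase_eq hl]
    have hm := prof_le_inf hl p.2 q.2
    have hm0 : 0 ≤ min (⨅ k : ℤ, |p.2 - q.2 + (k : ℝ) * l|) Real.pi :=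
      le_min (Real.iInf_nonneg fun _ => abs_nonneg _) hpi.le
    have hmp := min_le_right (⨅ k : ℤ, |p.2 - q.2 + (k : ℝ) * l|) Real.pi
    unfold coneDist
    generalize min (⨅ k : ℤ, |p.2 - q.2 + (k : ℝ) * l|) Real.pi = m at *
    rcases le_total q.1 p.1 with h | h
    · exact uTwoPhase_lip_aux hp.1 h hq.1 hm0 hmp (prof_mem _ _) hm
    · rw [abs_sub_comm] at hm ⊢
      have := uTwoPhase_lip_aux hq.1 h hp.1 hm0 hmp (prof_mem l (thetaMod l q.2)) hm
      convert this using 3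
      ring

/-! ### The energy of the profile -/

lemma deriv_uTwoPhase_r {l : ℝ} (hl : 4 * Real.pi ≤ l) (r θ : ℝ) :
    deriv (fun s => uTwoPhase l s θ) r = prof l (thetaMod l θ) := by
  simp_rw [uTwoPhase_eq hl]
  simp

lemma deriv_uTwoPhase_θ {l : ℝ} (hl : 4 * Real.pi ≤ l) (r θ : ℝ) (h : θ ∈ Ioo 0 l) :
    deriv (fun φ => uTwoPhase l r φ) θ = r * deriv (prof l) θ := by
  have : (fun φ => uTwoPhase l r φ) =ᶠ[nhds θ] fun φ => r * prof l φ := by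
    filter_upwards [isOpen_Ioo.mem_nhds h] with φ hφ
    rw [uTwoPhase_eq hl, thetaMod_of_mem hφ.1.le hφ.2]
  rw [this.deriv_eq, deriv_const_mul_field]

lemma bumpS_eventually_zero {t : ℝ} (h : t < 0 ∨ Real.pi < t) : bumpS =ᶠ[nhds t] fun _ => 0 := by
  rcases h with h | h
  · filter_upwards [isOpen_Iio.mem_nhds h] with φ hφ
    exact bumpS_of_nonpos (le_of_lt hφ)
  · filter_upwards [isOpen_Ioi.mem_nhds h] with φ hφ
    exact bumpS_of_ge (le_of_lt hφ)

lemma hasDerivAt_bumpS_zero {t : ℝ} (h : t < 0 ∨ Real.pi < t) : HasDerivAt bumpS 0 t :=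
  (hasDerivAt_const t (0:ℝ)).congr_of_eventuallyEq (bumpS_eventually_zero h)

lemma hasDerivAt_bumpS {t : ℝ} (h : t ∈ Ioo 0 Real.pi) : HasDerivAt bumpS (Real.cos t) t := by
  refine (Real.hasDerivAt_sin t).congr_of_eventuallyEq ?_
  filter_upwards [isOpen_Ioo.mem_nhds h] with φ hφ
  exact bumpS_of_mem hφ.1.le hφ.2.le

lemma deriv_prof {l t a b : ℝ} (h1 : HasDerivAt bumpS a t) (h2 : HasDerivAt bumpS b (t - l / 2)) :
    deriv (prof l) t = a + b := by
  have := h1.add (h2.comp_sub_const t (l / 2))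
  exact this.deriv

/-- The angular support of the profile. -/
def suppS (l : ℝ) : Set ℝ := Ioo 0 Real.pi ∪ Ioo (l / 2) (l / 2 + Real.pi)

lemma integrand_uTwoPhase {l : ℝ} (hl : 4 * Real.pi ≤ l) (p : ℝ × ℝ)
    (hp : p ∈ Ioo (0:ℝ) 1 ×ˢ Ioo (0:ℝ) l) (h1 : p.2 ≠ Real.pi) (h2 : p.2 ≠ l / 2)
    (h3 : p.2 ≠ l / 2 + Real.pi) :
    (gradSq (uTwoPhase l) p + (if 0 < uTwoPhase l p.1 p.2 then 1 else 0)
      + (if uTwoPhase l p.1 p.2 < 0 then 0 else 0)) * p.1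
      = (2 * p.1) * (suppS l).indicator (fun _ => 1) p.2 := by
  obtain ⟨⟨hr0, hr1⟩, ht⟩ := hp
  have hpi := Real.pi_pos
  unfold gradSq
  rw [deriv_uTwoPhase_r hl, deriv_uTwoPhase_θ hl _ _ ht, uTwoPhase_eq hl,
    thetaMod_of_mem ht.1.le ht.2]
  have hr2 : p.1 ≠ 0 := hr0.ne'
  have e : (p.1 * deriv (prof l) p.2) ^ 2 / p.1 ^ 2 = (deriv (prof l) p.2) ^ 2 := by
    field_simp
  rw [e, ite_self, add_zero]
  by_cases hA : p.2 ∈ Ioo 0 Real.pi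
  · have hd := deriv_prof (l := l) (hasDerivAt_bumpS hA)
      (hasDerivAt_bumpS_zero (Or.inl (by linarith [hA.2] : p.2 - l / 2 < 0)))
    have hv : prof l p.2 = Real.sin p.2 := by
      unfold prof; rw [bumpS_of_mem hA.1.le hA.2.le, bumpS_of_nonpos (by linarith [hA.2])]; ring
    have hs := Real.sin_pos_of_pos_of_lt_pi hA.1 hA.2
    rw [hd, hv, if_pos (mul_pos hr0 hs), indicator_of_mem (show p.2 ∈ suppS l from Or.inl hA)]
    nlinarith [Real.sin_sq_add_cos_sq p.2]
  have hA' : Real.pi < p.2 := by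
    by_contra hc
    exact hA ⟨ht.1, lt_of_le_of_ne (not_lt.1 hc) h1⟩
  by_cases hB : p.2 ∈ Ioo (l / 2) (l / 2 + Real.pi)
  · have hB' : p.2 - l / 2 ∈ Ioo 0 Real.pi := ⟨by linarith [hB.1], by linarith [hB.2]⟩
    have hd := deriv_prof (l := l) (hasDerivAt_bumpS_zero (Or.inr hA')) (hasDerivAt_bumpS hB')
    have hv : prof l p.2 = Real.sin (p.2 - l / 2) := by
      unfold prof; rw [bumpS_of_mem hB'.1.le hB'.2.le, bumpS_of_ge (by linarith)]; ring
    have hs := Real.sin_pos_of_pos_of_lt_pi hB'.1 hB'.2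
    rw [hd, hv, if_pos (mul_pos hr0 hs), indicator_of_mem (show p.2 ∈ suppS l from Or.inr hB)]
    nlinarith [Real.sin_sq_add_cos_sq (p.2 - l / 2)]
  have hB' : p.2 - l / 2 < 0 ∨ Real.pi < p.2 - l / 2 := by
    rcases lt_or_gt_of_ne h2 with h | h
    · left; linarith
    · right
      rcases lt_or_gt_of_ne h3 with h' | h'
      · exact absurd ⟨h, h'⟩ hB
      · linarith
  have hd := deriv_prof (l := l) (hasDerivAt_bumpS_zero (Or.inr hA')) (hasDerivAt_bumpS_zero hB')
  have hv : prof l p.2 = 0 := by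
    unfold prof
    rw [bumpS_of_ge hA'.le]
    have := (bumpS_eventually_zero hB').self_of_nhds
    simp only at this
    rw [this]; ring
  rw [hd, hv, indicator_of_notMem (by rintro (h | h); exacts [hA h, hB h])]
  simp

lemma integral_suppS {l : ℝ} (hl : 4 * Real.pi ≤ l) :
    ∫ t in Ioo (0:ℝ) l, (suppS l).indicator (fun _ => (1:ℝ)) t = 2 * Real.pi := by
  have hpi := Real.pi_pos
  have hm : MeasurableSet (suppS l) := measurableSet_Ioo.union measurableSet_Ioo
  rw [setIntegral_indicator hm]
  have : Ioo (0:ℝ) l ∩ suppS l = suppS l := by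
    apply inter_eq_right.2
    rintro x (h | h)
    · exact ⟨h.1, by linarith [h.2]⟩
    · exact ⟨by linarith [h.1], by linarith [h.2]⟩
  rw [this, suppS, setIntegral_union _ measurableSet_Ioo]
  · simp [hpi.le]; ring
  · exact integrableOn_const (by simp)
  · exact integrableOn_const (by simp)
  · rw [Set.disjoint_left]
    intro x h h'
    linarith [h.2, h'.1]

lemma Jfun_uTwoPhase {l : ℝ} (hl : 4 * Real.pi ≤ l) :
    Jfun l 1 0 (uTwoPhase l) 1 = 2 * Real.pi := by
  unfold Jfun
  have hms : MeasurableSet (Ioo (0:ℝ) 1 ×ˢ Ioo (0:ℝ) l) := measurableSet_Ioo.prod measurableSet_Ioo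
  have h1 : ∀ᵐ p : ℝ × ℝ, p.2 ≠ Real.pi ∧ p.2 ≠ l / 2 ∧ p.2 ≠ l / 2 + Real.pi := by
    have : ∀ᵐ t : ℝ, t ≠ Real.pi ∧ t ≠ l / 2 ∧ t ≠ l / 2 + Real.pi := by
      filter_upwards [Measure.ae_ne volume Real.pi, Measure.ae_ne volume (l/2),
        Measure.ae_ne volume (l/2 + Real.pi)] with t a b c
      exact ⟨a, b, c⟩
    exact Measure.quasiMeasurePreserving_snd.ae this
  have h2 : ∫ p in Ioo (0:ℝ) 1 ×ˢ Ioo (0:ℝ) l,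
      (gradSq (uTwoPhase l) p + (if 0 < uTwoPhase l p.1 p.2 then 1 else 0)
      + (if uTwoPhase l p.1 p.2 < 0 then 0 else 0)) * p.1 =
      ∫ p in Ioo (0:ℝ) 1 ×ˢ Ioo (0:ℝ) l,
        (2 * p.1) * (suppS l).indicator (fun _ => 1) p.2 := by
    apply setIntegral_congr_ae hms
    filter_upwards [h1] with p hp hm
    exact integrand_uTwoPhase hl p hm hp.1 hp.2.1 hp.2.2
  rw [h2, Measure.volume_eq_prod,
    setIntegral_prod_mul (fun r : ℝ => 2 * r) ((suppS l).indicator (fun _ => (1:ℝ))),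
    integral_suppS hl, ← integral_Ioc_eq_integral_Ioo,
    ← intervalIntegral.integral_of_le zero_le_one, intervalIntegral.integral_const_mul,
    integral_id]
  norm_num

/-! ### The calibration argument -/

/-- Clamping to `[0,1]`. -/
def clampI (r : ℝ) : ℝ := max 0 (min r 1)

lemma clampI_mem (r : ℝ) : clampI r ∈ Icc (0:ℝ) 1 :=
  ⟨le_max_left _ _, max_le zero_le_one (min_le_right _ _)⟩

lemma clampI_of_mem {r : ℝ} (h : r ∈ Icc (0:ℝ) 1) : clampI r = r := by
  simp [clampI, min_eq_left h.2, max_eq_right h.1]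

lemma clampI_lip (r s : ℝ) : |clampI r - clampI s| ≤ |r - s| := by
  refine (abs_max_sub_max_le_max _ _ _ _).trans ?_
  simp only [sub_self, abs_zero]
  refine max_le (abs_nonneg _) ((abs_min_sub_min_le_max _ _ _ _).trans ?_)
  simp

/-- Globally Lipschitz functions in polar coordinates. -/
structure GoodFn (K : ℝ) (v : ℝ → ℝ → ℝ) : Prop where
  K0 : 0 ≤ K
  lr : ∀ r s θ, |v r θ - v s θ| ≤ K * |r - s|
  lθ : ∀ r θ φ, |v r θ - v r φ| ≤ K * clampI r * |θ - φ|

lemma coneDist_radial (l r s θ : ℝ) : coneDist l (r, θ) (s, θ) = |r - s| := by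
  have h0 : (⨅ k : ℤ, |θ - θ + (k : ℝ) * l|) = 0 := by
    apply le_antisymm
    · have : BddBelow (range fun k : ℤ => |θ - θ + (k : ℝ) * l|) :=
        ⟨0, by rintro _ ⟨k, rfl⟩; exact abs_nonneg _⟩
      have := ciInf_le this 0
      simpa using this
    · exact Real.iInf_nonneg fun _ => abs_nonneg _
  unfold coneDist
  simp only [h0]
  rw [min_eq_left Real.pi_pos.le, Real.cos_zero, ← Real.sqrt_sq_eq_abs]
  congr 1; ring

lemma coneDist_angular (l r θ φ : ℝ) (hr : 0 ≤ r) :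
    coneDist l (r, θ) (r, φ) ≤ r * |θ - φ| := by
  have h0 : (⨅ k : ℤ, |θ - φ + (k : ℝ) * l|) ≤ |θ - φ| := by
    have : BddBelow (range fun k : ℤ => |θ - φ + (k : ℝ) * l|) :=
      ⟨0, by rintro _ ⟨k, rfl⟩; exact abs_nonneg _⟩
    have := ciInf_le this 0
    simpa using this
  have h1 : 0 ≤ min (⨅ k : ℤ, |θ - φ + (k : ℝ) * l|) Real.pi :=
      le_min (Real.iInf_nonneg fun _ => abs_nonneg _) Real.pi_pos.le
  have h2 := (min_le_left (⨅ k : ℤ, |θ - φ + (k : ℝ) * l|) Real.pi).trans h0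
  unfold coneDist
  simp only
  generalize min (⨅ k : ℤ, |θ - φ + (k : ℝ) * l|) Real.pi = m at *
  apply Real.sqrt_le_iff.2 ⟨by positivity, ?_⟩
  have h3 := Real.one_sub_sq_div_two_le_cos (x := m)
  have h4 : m ^ 2 ≤ |θ - φ| ^ 2 := by gcongr
  have h5 : r ^ 2 * (2 * (1 - Real.cos m)) ≤ r ^ 2 * |θ - φ| ^ 2 := by
    gcongr; linarith
  nlinarith

lemma goodFn_of_coneLip {l : ℝ} {w : ℝ → ℝ → ℝ} (hw : ConeLip l 1 w) :
    ∃ K, GoodFn K (fun r θ => w (clampI r) θ) := by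
  obtain ⟨K, hK⟩ := hw.lipschitz
  refine ⟨|K|, abs_nonneg _, fun r s θ => ?_, fun r θ φ => ?_⟩
  · have := hK (clampI r, θ) (clampI s, θ) (clampI_mem r) (clampI_mem s)
    rw [coneDist_radial] at this
    refine this.trans ?_
    have := clampI_lip r s
    calc K * |clampI r - clampI s| ≤ |K| * |clampI r - clampI s| := by gcongr; exact le_abs_self _
      _ ≤ _ := by gcongr
  · have := hK (clampI r, θ) (clampI r, φ) (clampI_mem r) (clampI_mem r)
    refine this.trans ?_
    have h := coneDist_angular l (clampI r) θ φ (clampI_mem r).1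
    have h0 : 0 ≤ coneDist l (clampI r, θ) (clampI r, φ) := Real.sqrt_nonneg _
    calc K * coneDist l (clampI r, θ) (clampI r, φ)
        ≤ |K| * coneDist l (clampI r, θ) (clampI r, φ) := by gcongr; exact le_abs_self _
      _ ≤ |K| * (clampI r * |θ - φ|) := by gcongr
      _ = _ := by ring

namespace GoodFn

variable {K : ℝ} {v : ℝ → ℝ → ℝ}

lemma lθ' (h : GoodFn K v) (r θ φ : ℝ) : |v r θ - v r φ| ≤ K * |θ - φ| := by
  refine (h.lθ r θ φ).trans ?_
  have := (clampI_mem r)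
  have h2 : K * clampI r ≤ K * 1 := mul_le_mul_of_nonneg_left this.2 h.K0
  rw [mul_one] at h2
  gcongr

lemma lipr (h : GoodFn K v) (θ : ℝ) : LipschitzWith K.toNNReal (fun s => v s θ) :=
  LipschitzWith.of_dist_le_mul fun r s => by
    rw [Real.dist_eq, Real.dist_eq, Real.coe_toNNReal _ h.K0]; exact h.lr r s θ

lemma lipθ (h : GoodFn K v) (r : ℝ) : LipschitzWith K.toNNReal (fun φ => v r φ) :=
  LipschitzWith.of_dist_le_mul fun θ φ => by
    rw [Real.dist_eq, Real.dist_eq, Real.coe_toNNReal _ h.K0]; exact h.lθ' r θ φ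

lemma cont (h : GoodFn K v) : Continuous (Function.uncurry v) := by
  have : LipschitzWith (2 * K).toNNReal (Function.uncurry v) :=
    LipschitzWith.of_dist_le_mul fun p q => by
      rw [Real.coe_toNNReal _ (by linarith [h.K0]), Real.dist_eq]
      have h1 := h.lr p.1 q.1 p.2
      have h2 := h.lθ' q.1 p.2 q.2
      have h3 : |p.1 - q.1| ≤ dist p q := le_max_left _ _
      have h4 : |p.2 - q.2| ≤ dist p q := le_max_right _ _
      have h5 := abs_sub_le (v p.1 p.2) (v q.1 p.2) (v q.1 q.2)
      have h6 := mul_le_mul_of_nonneg_left h3 h.K0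
      have h7 := mul_le_mul_of_nonneg_left h4 h.K0
      simp only [Function.uncurry]
      linarith
  exact this.continuous

lemma pos (h : GoodFn K v) : GoodFn K (fun r θ => max (v r θ) 0) where
  K0 := h.K0
  lr r s θ := (abs_max_sub_max_le_abs _ _ _).trans (h.lr r s θ)
  lθ r θ φ := (abs_max_sub_max_le_abs _ _ _).trans (h.lθ r θ φ)

lemma meas_dθ (h : GoodFn K v) : Measurable fun p : ℝ × ℝ => deriv (fun φ => v p.1 φ) p.2 :=
  measurable_deriv_with_param h.cont

lemma meas_dr (h : GoodFn K v) : Measurable fun p : ℝ × ℝ => deriv (fun s => v s p.2) p.1 := by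
  have : Continuous (Function.uncurry fun θ r => v r θ) := h.cont.comp continuous_swap
  exact (measurable_deriv_with_param this).comp measurable_swap

lemma bdd_dr (h : GoodFn K v) (r θ : ℝ) : |deriv (fun s => v s θ) r| ≤ K := by
  have := norm_deriv_le_of_lipschitz (x₀ := r) (h.lipr θ)
  rwa [Real.coe_toNNReal _ h.K0] at this

lemma bdd_dθ (h : GoodFn K v) (r θ : ℝ) : |deriv (fun φ => v r φ) θ| ≤ K * clampI r := by
  have h0 : 0 ≤ K * clampI r := mul_nonneg h.K0 (clampI_mem r).1
  have hl : LipschitzWith (K * clampI r).toNNReal (fun φ => v r φ) :=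
    LipschitzWith.of_dist_le_mul fun θ φ => by
      rw [Real.dist_eq, Real.dist_eq, Real.coe_toNNReal _ h0]; exact h.lθ r θ φ
  have := norm_deriv_le_of_lipschitz (x₀ := θ) hl
  rwa [Real.coe_toNNReal _ h0] at this

lemma bdd_dθ' (h : GoodFn K v) (r θ : ℝ) : |deriv (fun φ => v r φ) θ| ≤ K := by
  have h2 : K * clampI r ≤ K * 1 := mul_le_mul_of_nonneg_left (clampI_mem r).2 h.K0
  linarith [h.bdd_dθ r θ]

end GoodFn

lemma integrableOn_rect_of_bdd {f : ℝ × ℝ → ℝ} (hf : Measurable f) {C a b c d : ℝ}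
    (hC : ∀ p ∈ Ioc a b ×ˢ Ioc c d, |f p| ≤ C) :
    IntegrableOn f (Ioc a b ×ˢ Ioc c d) := by
  have hm : MeasurableSet (Ioc a b ×ˢ Ioc c d) := measurableSet_Ioc.prod measurableSet_Ioc
  refine Measure.integrableOn_of_bounded (M := C) ?_ hf.aestronglyMeasurable ?_
  · rw [Measure.volume_eq_prod, Measure.prod_prod]
    exact ENNReal.mul_ne_top (by simp) (by simp)
  · exact (ae_restrict_iff' hm).2 (Filter.Eventually.of_forall hC)

lemma intervalIntegrable_inner {f : ℝ × ℝ → ℝ} {a b c d : ℝ} (hab : a ≤ b) (hcd : c ≤ d)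
    (hf : IntegrableOn f (Ioc a b ×ˢ Ioc c d)) :
    IntervalIntegrable (fun r => ∫ θ in c..d, f (r, θ)) volume a b := by
  rw [intervalIntegrable_iff_integrableOn_Ioc_of_le hab]
  simp_rw [intervalIntegral.integral_of_le hcd]
  rw [IntegrableOn, Measure.volume_eq_prod, ← Measure.prod_restrict] at hf
  exact hf.integral_prod_left

lemma intervalIntegrable_of_bdd {f : ℝ → ℝ} (hf : Measurable f) {C a b : ℝ}
    (hC : ∀ p, |f p| ≤ C) : IntervalIntegrable f volume a b := by
  rw [intervalIntegrable_iff]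
  refine Measure.integrableOn_of_bounded (M := C) (by simp [uIoc]) hf.aestronglyMeasurable ?_
  exact Filter.Eventually.of_forall hC

/-- The calibration integrand. -/
def calib (a : ℝ) (p : ℝ → ℝ → ℝ) (q : ℝ × ℝ) : ℝ :=
  q.1 * Real.sin (q.2 - a) * deriv (fun s => p s q.2) q.1
    + Real.cos (q.2 - a) * deriv (fun φ => p q.1 φ) q.2

section calibSection

variable {K : ℝ} {p : ℝ → ℝ → ℝ}

lemma calib_meas (h : GoodFn K p) (a : ℝ) : Measurable (calib a p) := by
  have h1 := h.meas_dr
  have h2 := h.meas_dθ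
  unfold calib
  fun_prop

lemma calib_bdd (h : GoodFn K p) (a : ℝ) (q : ℝ × ℝ) (hq : q.1 ∈ Icc (0:ℝ) 1) :
    |calib a p q| ≤ 2 * K := by
  have h1 := h.bdd_dr q.1 q.2
  have h2 := h.bdd_dθ' q.1 q.2
  unfold calib
  refine (abs_add_le _ _).trans ?_
  have e1 : |q.1 * Real.sin (q.2 - a) * deriv (fun s => p s q.2) q.1| ≤ 1 * 1 * K := by
    rw [abs_mul, abs_mul, abs_of_nonneg hq.1]
    have := Real.abs_sin_le_one (q.2 - a)
    have := hq.1
    gcongr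
    exact hq.2
  have e2 : |Real.cos (q.2 - a) * deriv (fun φ => p q.1 φ) q.2| ≤ 1 * K := by
    rw [abs_mul]
    have := Real.abs_cos_le_one (q.2 - a)
    gcongr
  linarith

lemma calib_integrableOn (h : GoodFn K p) (a c d : ℝ) :
    IntegrableOn (calib a p) (Ioc 0 1 ×ˢ Ioc c d) :=
  integrableOn_rect_of_bdd (calib_meas h a) (C := 2 * K)
    fun q hq => calib_bdd h a q ⟨hq.1.1.le, hq.1.2⟩

lemma calib_inner (h : GoodFn K p) (a r : ℝ) :
    ∫ θ in (a - Real.pi / 2)..(a + 3 * Real.pi / 2), calib a p (r, θ) =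
    ∫ θ in (a - Real.pi / 2)..(a + 3 * Real.pi / 2),
      Real.sin (θ - a) * (r * deriv (fun s => p s θ) r + p r θ) := by
  have hcos : ∀ θ, HasDerivAt (fun θ => Real.cos (θ - a)) (-Real.sin (θ - a)) θ := fun θ =>
    (Real.hasDerivAt_cos (θ - a)).comp_sub_const θ a
  have hcosAC : AbsolutelyContinuousOnInterval (fun θ => Real.cos (θ - a))
      (a - Real.pi / 2) (a + 3 * Real.pi / 2) := by
    have hl : LipschitzWith 1 (fun θ => Real.cos (θ - a)) := by
      refine LipschitzWith.of_dist_le_mul fun x y => ?_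
      have := Real.lipschitzWith_cos.dist_le_mul (x - a) (y - a)
      simpa [Real.dist_eq] using this
    exact (hl.lipschitzOnWith (s := _)).absolutelyContinuousOnInterval
  have hpAC : AbsolutelyContinuousOnInterval (fun θ => p r θ)
      (a - Real.pi / 2) (a + 3 * Real.pi / 2) :=
    ((h.lipθ r).lipschitzOnWith (s := _)).absolutelyContinuousOnInterval
  have ibp := hcosAC.integral_mul_deriv_eq_deriv_mul hpAC
  have c1 : Real.cos (a + 3 * Real.pi / 2 - a) = 0 := by
    rw [show a + 3 * Real.pi / 2 - a = Real.pi / 2 + Real.pi by ring, Real.cos_add_pi,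
      Real.cos_pi_div_two, neg_zero]
  have c2 : Real.cos (a - Real.pi / 2 - a) = 0 := by
    rw [show a - Real.pi / 2 - a = -(Real.pi / 2) by ring, Real.cos_neg, Real.cos_pi_div_two]
  simp only [c1, c2, (hcos _).deriv, zero_mul, sub_zero, zero_sub, neg_mul,
    intervalIntegral.integral_neg, neg_neg] at ibp
  have hdr : Measurable fun θ => deriv (fun s => p s θ) r :=
    h.meas_dr.comp (measurable_const.prodMk measurable_id)
  have hdθ : Measurable fun θ => deriv (fun φ => p r φ) θ := measurable_deriv _
  have i1 : IntervalIntegrable (fun θ => r * Real.sin (θ - a) * deriv (fun s => p s θ) r) volume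
      (a - Real.pi / 2) (a + 3 * Real.pi / 2) := by
    have := (intervalIntegrable_of_bdd (a := a - Real.pi / 2) (b := a + 3 * Real.pi / 2)
      hdr (fun θ => h.bdd_dr r θ))
    exact this.continuousOn_mul (by fun_prop)
  have i2 : IntervalIntegrable (fun θ => Real.cos (θ - a) * deriv (fun φ => p r φ) θ) volume
      (a - Real.pi / 2) (a + 3 * Real.pi / 2) := by
    have := (intervalIntegrable_of_bdd (a := a - Real.pi / 2) (b := a + 3 * Real.pi / 2)
      hdθ (fun θ => h.bdd_dθ' r θ))
    exact this.continuousOn_mul (by fun_prop)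
  have i3 : IntervalIntegrable (fun θ => Real.sin (θ - a) * p r θ) volume
      (a - Real.pi / 2) (a + 3 * Real.pi / 2) := by
    have := (h.lipθ r).continuous
    apply Continuous.intervalIntegrable
    fun_prop
  unfold calib
  simp only
  rw [intervalIntegral.integral_add i1 i2, ibp, ← intervalIntegral.integral_add i1 i3]
  congr 1; ext θ; ring

lemma calib_total (h : GoodFn K p) (a : ℝ) :
    ∫ r in (0:ℝ)..1, ∫ θ in (a - Real.pi / 2)..(a + 3 * Real.pi / 2), calib a p (r, θ) =
    ∫ θ in (a - Real.pi / 2)..(a + 3 * Real.pi / 2), Real.sin (θ - a) * p 1 θ := by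
  have hpi := Real.pi_pos
  simp_rw [calib_inner h]
  rw [intervalIntegral_intervalIntegral_swap]
  · congr 1; ext θ
    rw [intervalIntegral.integral_const_mul]
    congr 1
    have hid : AbsolutelyContinuousOnInterval (fun r : ℝ => r) 0 1 :=
      (LipschitzWith.id.lipschitzOnWith (s := _)).absolutelyContinuousOnInterval
    have hpAC : AbsolutelyContinuousOnInterval (fun r => p r θ) 0 1 :=
      ((h.lipr θ).lipschitzOnWith (s := _)).absolutelyContinuousOnInterval
    have := hid.integral_deriv_mul_eq_sub hpAC
    simp only [deriv_id'', one_mul, zero_mul, sub_zero] at this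
    rw [← this]
    congr 1; ext r; ring
  · rw [uIoc_of_le zero_le_one, uIoc_of_le (by linarith)]
    have hm := h.meas_dr
    have j1 : IntegrableOn (fun q : ℝ × ℝ => Real.sin (q.2 - a) *
        (q.1 * deriv (fun s => p s q.2) q.1))
        (Ioc 0 1 ×ˢ Ioc (a - Real.pi / 2) (a + 3 * Real.pi / 2)) := by
      refine integrableOn_rect_of_bdd (C := 1 * (1 * K)) (by fun_prop) fun q hq => ?_
      have h1 := h.bdd_dr q.1 q.2
      have := Real.abs_sin_le_one (q.2 - a)
      have h0 := hq.1.1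
      rw [abs_mul, abs_mul, abs_of_nonneg h0.le]
      gcongr
      exact hq.1.2
    have j2 : IntegrableOn (fun q : ℝ × ℝ => Real.sin (q.2 - a) * p q.1 q.2)
        (Ioc 0 1 ×ˢ Ioc (a - Real.pi / 2) (a + 3 * Real.pi / 2)) := by
      have hc : Continuous fun q : ℝ × ℝ => p q.1 q.2 := h.cont
      have hc2 : Continuous fun q : ℝ × ℝ => Real.sin (q.2 - a) * p q.1 q.2 := by fun_prop
      have hk : IsCompact (Icc (0:ℝ) 1 ×ˢ Icc (a - Real.pi / 2) (a + 3 * Real.pi / 2)) :=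
        isCompact_Icc.prod isCompact_Icc
      exact (hc2.continuousOn.integrableOn_compact hk).mono_set
        (prod_mono Ioc_subset_Icc_self Ioc_subset_Icc_self)
    refine (j1.add j2).congr_fun (fun q _ => ?_) (measurableSet_Ioc.prod measurableSet_Ioc)
    simp only [Pi.add_apply, Function.uncurry]
    ring

end calibSection

/-! ### The lower bound -/

/-- The energy density. -/
def dens (v : ℝ → ℝ → ℝ) (q : ℝ × ℝ) : ℝ :=
  (gradSq v q + (if 0 < v q.1 q.2 then 1 else 0)) * q.1

lemma calib_le_dens {K : ℝ} {v : ℝ → ℝ → ℝ} (h : GoodFn K v) (a : ℝ) (q : ℝ × ℝ) (hq : 0 < q.1) :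
    2 * calib a (fun r θ => max (v r θ) 0) q ≤ dens v q := by
  obtain ⟨r, θ⟩ := q
  simp only at hq
  unfold calib dens gradSq
  simp only
  by_cases hv : 0 < v r θ
  · have e1 : deriv (fun s => max (v s θ) 0) r = deriv (fun s => v s θ) r := by
      apply Filter.EventuallyEq.deriv_eq
      filter_upwards [(h.lipr θ).continuous.continuousAt.eventually (lt_mem_nhds hv)] with s hs
      exact max_eq_left hs.le
    have e2 : deriv (fun φ => max (v r φ) 0) θ = deriv (fun φ => v r φ) θ := by
      apply Filter.EventuallyEq.deriv_eq
      filter_upwards [(h.lipθ r).continuous.continuousAt.eventually (lt_mem_nhds hv)] with s hs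
      exact max_eq_left hs.le
    rw [e1, e2, if_pos hv]
    generalize deriv (fun s => v s θ) r = x
    obtain ⟨y, hy⟩ : ∃ y, deriv (fun φ => v r φ) θ = r * y :=
      ⟨deriv (fun φ => v r φ) θ / r, by field_simp⟩
    rw [hy, show (r * y) ^ 2 / r ^ 2 = y ^ 2 by field_simp]
    have hsc := Real.sin_sq_add_cos_sq (θ - a)
    have : 0 ≤ r * ((x - Real.sin (θ - a)) ^ 2 + (y - Real.cos (θ - a)) ^ 2) := by positivity
    nlinarith
  · have hz : max (v r θ) 0 = 0 := max_eq_right (not_lt.1 hv)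
    have e1 : deriv (fun s => max (v s θ) 0) r = 0 := by
      apply IsLocalMin.deriv_eq_zero
      filter_upwards with s
      rw [hz]; exact le_max_right _ _
    have e2 : deriv (fun φ => max (v r φ) 0) θ = 0 := by
      apply IsLocalMin.deriv_eq_zero
      filter_upwards with s
      rw [hz]; exact le_max_right _ _
    rw [e1, e2, if_neg hv]
    simp only [mul_zero, add_zero]
    positivity

lemma dens_nonneg (v : ℝ → ℝ → ℝ) (q : ℝ × ℝ) (hq : 0 ≤ q.1) : 0 ≤ dens v q := by
  unfold dens gradSq
  have : (0:ℝ) ≤ if 0 < v q.1 q.2 then 1 else 0 := by split_ifs <;> norm_num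
  positivity

lemma dens_meas {K : ℝ} {v : ℝ → ℝ → ℝ} (h : GoodFn K v) : Measurable (dens v) := by
  have h1 := h.meas_dr
  have h2 := h.meas_dθ
  have h3 : Measurable fun q : ℝ × ℝ => v q.1 q.2 := h.cont.measurable
  have h4 : Measurable fun q : ℝ × ℝ => if 0 < v q.1 q.2 then (1:ℝ) else 0 :=
    Measurable.ite (measurableSet_lt measurable_const h3) measurable_const measurable_const
  unfold dens gradSq
  fun_prop

lemma dens_bdd {K : ℝ} {v : ℝ → ℝ → ℝ} (h : GoodFn K v) (q : ℝ × ℝ) (hq : q.1 ∈ Ioc (0:ℝ) 1) :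
    |dens v q| ≤ K ^ 2 + K ^ 2 + 1 := by
  rw [abs_of_nonneg (dens_nonneg v q hq.1.le)]
  obtain ⟨h0, h1⟩ := hq
  have a1 := h.bdd_dr q.1 q.2
  have a2 := h.bdd_dθ q.1 q.2
  rw [clampI_of_mem ⟨h0.le, h1⟩] at a2
  have b1 : deriv (fun s => v s q.2) q.1 ^ 2 ≤ K ^ 2 := by
    rw [← sq_abs]; gcongr
  have b2 : deriv (fun φ => v q.1 φ) q.2 ^ 2 / q.1 ^ 2 ≤ K ^ 2 := by
    rw [div_le_iff₀ (by positivity), ← mul_pow, ← sq_abs]; gcongr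
  have b3 : (if 0 < v q.1 q.2 then (1:ℝ) else 0) ≤ 1 := by split_ifs <;> norm_num
  have b4 : (0:ℝ) ≤ if 0 < v q.1 q.2 then 1 else 0 := by split_ifs <;> norm_num
  unfold dens gradSq
  calc _ ≤ (K ^ 2 + K ^ 2 + 1) * 1 := by gcongr
    _ = _ := by ring

lemma dens_integrableOn {K : ℝ} {v : ℝ → ℝ → ℝ} (h : GoodFn K v) (c d : ℝ) :
    IntegrableOn (dens v) (Ioc 0 1 ×ˢ Ioc c d) :=
  integrableOn_rect_of_bdd (dens_meas h) fun q hq => dens_bdd h q hq.1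

lemma Jfun_eq {l K : ℝ} (hl : 0 ≤ l) {w : ℝ → ℝ → ℝ} (h : GoodFn K (fun r θ => w (clampI r) θ)) :
    Jfun l 1 0 w 1 =
      ∫ r in (0:ℝ)..1, ∫ θ in (0:ℝ)..l, dens (fun r θ => w (clampI r) θ) (r, θ) := by
  unfold Jfun
  have hms : MeasurableSet (Ioo (0:ℝ) 1 ×ˢ Ioo (0:ℝ) l) := measurableSet_Ioo.prod measurableSet_Ioo
  have h1 : ∫ p in Ioo (0:ℝ) 1 ×ˢ Ioo (0:ℝ) l, (gradSq w p + (if 0 < w p.1 p.2 then 1 else 0)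
      + (if w p.1 p.2 < 0 then 0 else 0)) * p.1 =
      ∫ p in Ioo (0:ℝ) 1 ×ˢ Ioo (0:ℝ) l, dens (fun r θ => w (clampI r) θ) p := by
    apply setIntegral_congr_fun hms
    intro p hp
    have hc : clampI p.1 = p.1 := clampI_of_mem ⟨hp.1.1.le, hp.1.2.le⟩
    have e1 : deriv (fun s => w (clampI s) p.2) p.1 = deriv (fun s => w s p.2) p.1 := by
      apply Filter.EventuallyEq.deriv_eq
      filter_upwards [isOpen_Ioo.mem_nhds hp.1] with s hs
      rw [clampI_of_mem ⟨hs.1.le, hs.2.le⟩]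
    simp only [dens, gradSq, e1, hc, ite_self, add_zero]
  rw [h1, Measure.volume_eq_prod, setIntegral_prod]
  · rw [intervalIntegral.integral_of_le zero_le_one, integral_Ioc_eq_integral_Ioo]
    simp_rw [intervalIntegral.integral_of_le hl, integral_Ioc_eq_integral_Ioo]
  · exact (dens_integrableOn h 0 l).mono_set (prod_mono Ioo_subset_Ioc_self Ioo_subset_Ioc_self)

lemma slice_bound {l K : ℝ} (hl : 4 * Real.pi ≤ l) {v : ℝ → ℝ → ℝ} (h : GoodFn K v)
    (hper : ∀ r θ, v r (θ + l) = v r θ) (r : ℝ) (hr : r ∈ Ioc (0:ℝ) 1) :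
    2 * (∫ θ in (0 - Real.pi / 2)..(0 + 3 * Real.pi / 2),
        calib 0 (fun r θ => max (v r θ) 0) (r, θ)) +
      2 * (∫ θ in (l / 2 - Real.pi / 2)..(l / 2 + 3 * Real.pi / 2),
        calib (l / 2) (fun r θ => max (v r θ) 0) (r, θ))
      ≤ ∫ θ in (0:ℝ)..l, dens v (r, θ) := by
  have hpi := Real.pi_pos
  have hdm : Measurable fun θ => dens v (r, θ) :=
    (dens_meas h).comp (measurable_const.prodMk measurable_id)
  have hdi : ∀ c d, IntervalIntegrable (fun θ => dens v (r, θ)) volume c d := fun c d =>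
    intervalIntegrable_of_bdd hdm fun θ => dens_bdd h (r, θ) hr
  have hci : ∀ a c d, IntervalIntegrable
      (fun θ => calib a (fun r θ => max (v r θ) 0) (r, θ)) volume c d := fun a c d =>
    intervalIntegrable_of_bdd ((calib_meas h.pos a).comp (measurable_const.prodMk measurable_id))
      fun θ => calib_bdd h.pos a (r, θ) ⟨hr.1.le, hr.2⟩
  have hp : Function.Periodic (fun θ => dens v (r, θ)) l := by
    intro θ
    have e1 : (fun s => v s (θ + l)) = fun s => v s θ := by ext s; exact hper s θ
    have e2 : deriv (fun φ => v r φ) (θ + l) = deriv (fun φ => v r φ) θ := by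
      rw [← deriv_comp_add_const]
      simp_rw [hper]
    simp only [dens, gradSq, e1, e2, hper]
  have hshift := hp.intervalIntegral_add_eq 0 (0 - Real.pi / 2)
  rw [zero_add] at hshift
  rw [hshift]
  have key : ∀ a, 2 * (∫ θ in (a - Real.pi / 2)..(a + 3 * Real.pi / 2),
      calib a (fun r θ => max (v r θ) 0) (r, θ)) ≤
      ∫ θ in (a - Real.pi / 2)..(a + 3 * Real.pi / 2), dens v (r, θ) := by
    intro a
    rw [← intervalIntegral.integral_const_mul]
    exact intervalIntegral.integral_mono_on (by linarith) ((hci a _ _).const_mul 2) (hdi _ _)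
      fun θ _ => calib_le_dens h a (r, θ) hr.1
  have nn : ∀ c d, c ≤ d → 0 ≤ ∫ θ in c..d, dens v (r, θ) := fun c d hcd =>
    intervalIntegral.integral_nonneg hcd fun θ _ => dens_nonneg v _ hr.1.le
  have s1 := intervalIntegral.integral_add_adjacent_intervals
    (hdi (0 - Real.pi / 2) (0 + 3 * Real.pi / 2)) (hdi _ (l / 2 - Real.pi / 2))
  have s2 := intervalIntegral.integral_add_adjacent_intervals
    (hdi (0 - Real.pi / 2) (l / 2 - Real.pi / 2)) (hdi _ (l / 2 + 3 * Real.pi / 2))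
  have s3 := intervalIntegral.integral_add_adjacent_intervals
    (hdi (0 - Real.pi / 2) (l / 2 + 3 * Real.pi / 2)) (hdi _ (0 - Real.pi / 2 + l))
  have n1 := nn (0 + 3 * Real.pi / 2) (l / 2 - Real.pi / 2) (by linarith)
  have n2 := nn (l / 2 + 3 * Real.pi / 2) (0 - Real.pi / 2 + l) (by linarith)
  have k1 := key 0
  have k2 := key (l / 2)
  linarith

lemma bump_integral (f : ℝ → ℝ) (a : ℝ)
    (hf : ∀ t ∈ Icc (-(Real.pi / 2)) (3 * Real.pi / 2), f (t + a) = bumpS t) :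
    ∫ θ in (a - Real.pi / 2)..(a + 3 * Real.pi / 2), Real.sin (θ - a) * f θ = Real.pi / 2 := by
  have hpi := Real.pi_pos
  have e : ∫ θ in (a - Real.pi / 2)..(a + 3 * Real.pi / 2), Real.sin (θ - a) * f θ =
      ∫ t in (-(Real.pi / 2))..(3 * Real.pi / 2), Real.sin t * f (t + a) := by
    have := intervalIntegral.integral_comp_add_right (a := -(Real.pi / 2)) (b := 3 * Real.pi / 2)
      (fun θ => Real.sin (θ - a) * f θ) a
    simp only [add_sub_cancel_right] at this
    rw [this]
    congr 1 <;> ring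
  have e2 : ∫ t in (-(Real.pi / 2))..(3 * Real.pi / 2), Real.sin t * f (t + a) =
      ∫ t in (-(Real.pi / 2))..(3 * Real.pi / 2), Real.sin t * bumpS t := by
    apply intervalIntegral.integral_congr
    intro t ht
    rw [uIcc_of_le (by linarith)] at ht
    simp only [hf t ht]
  have hc : Continuous bumpS := by unfold bumpS; fun_prop
  have hi : ∀ c d, IntervalIntegrable (fun t => Real.sin t * bumpS t) volume c d := fun c d =>
    (Real.continuous_sin.mul hc).intervalIntegrable c d
  have z1 : ∫ t in (-(Real.pi / 2))..0, Real.sin t * bumpS t = 0 := by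
    rw [intervalIntegral.integral_congr (g := fun _ => (0:ℝ))]
    · simp
    · intro t ht
      rw [uIcc_of_le (by linarith)] at ht
      simp [bumpS_of_nonpos ht.2]
  have z2 : ∫ t in Real.pi..(3 * Real.pi / 2), Real.sin t * bumpS t = 0 := by
    rw [intervalIntegral.integral_congr (g := fun _ => (0:ℝ))]
    · simp
    · intro t ht
      rw [uIcc_of_le (by linarith)] at ht
      simp [bumpS_of_ge ht.1]
  have z3 : ∫ t in (0:ℝ)..Real.pi, Real.sin t * bumpS t = Real.pi / 2 := by
    rw [intervalIntegral.integral_congr (g := fun t => Real.sin t ^ 2)]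
    · rw [integral_sin_sq]; simp
    · intro t ht
      rw [uIcc_of_le (by linarith)] at ht
      simp only [bumpS_of_mem ht.1 ht.2]; ring
  have s1 := intervalIntegral.integral_add_adjacent_intervals (hi (-(Real.pi / 2)) 0) (hi 0 Real.pi)
  have s2 := intervalIntegral.integral_add_adjacent_intervals (hi (-(Real.pi / 2)) Real.pi)
    (hi Real.pi (3 * Real.pi / 2))
  rw [e, e2]
  linarith

lemma boundary_zero {l : ℝ} (hl : 4 * Real.pi ≤ l) (t : ℝ)
    (ht : t ∈ Icc (-(Real.pi / 2)) (3 * Real.pi / 2)) :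
    prof l (thetaMod l (t + 0)) = bumpS t := by
  have hpi := Real.pi_pos
  obtain ⟨h1, h2⟩ := ht
  rw [add_zero]
  rcases lt_or_ge t 0 with h | h
  · rw [← thetaMod_add (by linarith), thetaMod_of_mem (by linarith) (by linarith), prof,
      bumpS_of_ge (by linarith), bumpS_of_ge (by linarith), bumpS_of_nonpos h.le, add_zero]
  · rw [thetaMod_of_mem h (by linarith), prof, bumpS_of_nonpos (t := t - l / 2) (by linarith),
      add_zero]

lemma boundary_half {l : ℝ} (hl : 4 * Real.pi ≤ l) (t : ℝ)
    (ht : t ∈ Icc (-(Real.pi / 2)) (3 * Real.pi / 2)) :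
    prof l (thetaMod l (t + l / 2)) = bumpS t := by
  have hpi := Real.pi_pos
  obtain ⟨h1, h2⟩ := ht
  rw [thetaMod_of_mem (by linarith) (by linarith), prof, bumpS_of_ge (t := t + l / 2) (by linarith),
      add_sub_cancel_right, zero_add]

lemma Jfun_lower {l : ℝ} (hl : 4 * Real.pi ≤ l) {w : ℝ → ℝ → ℝ} (hw : ConeLip l 1 w)
    (hb : ∀ θ, w 1 θ = uTwoPhase l 1 θ) : 2 * Real.pi ≤ Jfun l 1 0 w 1 := by
  have hpi := Real.pi_pos
  obtain ⟨K, hK⟩ := goodFn_of_coneLip hw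
  rw [Jfun_eq (by linarith) hK]
  have hper : ∀ r θ, (fun r θ => w (clampI r) θ) r (θ + l) = (fun r θ => w (clampI r) θ) r θ :=
    fun r θ => hw.periodic _ _
  have hone : ∀ θ, (fun r θ => max (w (clampI r) θ) 0) 1 θ = prof l (thetaMod l θ) := by
    intro θ
    simp only
    rw [clampI_of_mem ⟨zero_le_one, le_rfl⟩, hb, uTwoPhase_eq hl, one_mul,
      max_eq_left (prof_mem _ _).1]
  generalize hv : (fun r θ => w (clampI r) θ) = v at *
  have hone' : ∀ θ, max (v 1 θ) 0 = prof l (thetaMod l θ) := by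
    intro θ; rw [← hone θ, ← hv]
  have t1 := calib_total hK.pos 0
  have t2 := calib_total hK.pos (l / 2)
  simp only [hone'] at t1 t2
  rw [bump_integral (fun θ => prof l (thetaMod l θ)) 0 (boundary_zero hl)] at t1
  rw [bump_integral (fun θ => prof l (thetaMod l θ)) (l / 2) (boundary_half hl)] at t2
  have i1 := (intervalIntegrable_inner zero_le_one (by linarith)
    (calib_integrableOn hK.pos 0 (0 - Real.pi / 2) (0 + 3 * Real.pi / 2))).const_mul 2
  have i2 := (intervalIntegrable_inner zero_le_one (by linarith)
    (calib_integrableOn hK.pos (l / 2) (l / 2 - Real.pi / 2) (l / 2 + 3 * Real.pi / 2))).const_mul 2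
  have i3 := intervalIntegrable_inner zero_le_one (by linarith) (dens_integrableOn hK 0 l)
  have hmono := intervalIntegral.integral_mono_on_of_le_Ioo zero_le_one (i1.add i2) i3
    (fun r hr => slice_bound hl hK hper r ⟨hr.1, hr.2.le⟩)
  rw [intervalIntegral.integral_add i1 i2, intervalIntegral.integral_const_mul,
    intervalIntegral.integral_const_mul, t1, t2] at hmono
  linarith

/-- On a cone of length `l ≥ 4π`, the profile consisting of two linear bumps supported
on `θ ∈ [0, π]` and `θ ∈ [l/2, l/2 + π]` is a minimizer of `J(C_1, 1, 0)`. In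
particular two distinct positive phases of this one-phase minimizer meet at the
vertex. -/
theorem two_positive_phases_through_vertex (l : ℝ) (hl : 4 * Real.pi ≤ l) :
    IsMinimizerJ l 1 0 1 (uTwoPhase l) := by
  exact ⟨uTwoPhase_coneLip hl, fun w hw hb => by
    rw [Jfun_uTwoPhase hl]; exact Jfun_lower hl hw hb⟩
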